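/- Let 𝛂 and 𝛃 be finite tuples of multiplicative characters of κ, and let α, β be multiplicative characters of κ with α ≠ β. Then for every λ ∈ κ: −j(α, ᾱβ) · F(𝛂⌢(α), 𝛃⌢(β); λ) = ∑_{t∈κ} F(𝛂, 𝛃; λ·t) · α(t) · (ᾱβ)(1−t), where 𝛂⌢(α) denotes the tuple 𝛂 with α appended. -/

import Mathlib

/-!
Finite-field hypergeometric functions (Otsubo), basic definitions:
`κ` is a finite field with `q = Fintype.card κ` elements, `ψ` a fixed nontrivial
additive character, multiplicative characters are `MulChar κ ℂ` (extended by `0`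
on `0`, with trivial character `1`).
-/

open scoped Classical

noncomputable section

variable {κ : Type*} [Field κ] [Fintype κ]

instance : Fintype (MulChar κ ℂ) := Fintype.ofFinite _

/-- The Gauss sum `g(φ) = -∑_{x ∈ κ} ψ(x) φ(x)`. -/
def gS (ψ : AddChar κ ℂ) (φ : MulChar κ ℂ) : ℂ := -∑ x : κ, ψ x * φ x

/-- The variant `g°(φ) = q^{δ(φ)} · g(φ)`, where `δ(φ) = 1` iff `φ` is trivial. -/
def gSo (ψ : AddChar κ ℂ) (φ : MulChar κ ℂ) : ℂ :=
  (if φ = 1 then (Fintype.card κ : ℂ) else 1) * gS ψ φ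

/-- The Pochhammer symbol `(α)_ν = g(αν)/g(α)`. -/
def poch (ψ : AddChar κ ℂ) (α ν : MulChar κ ℂ) : ℂ := gS ψ (α * ν) / gS ψ α

/-- The variant Pochhammer symbol `(α)°_ν = g°(αν)/g°(α)`. -/
def pocho (ψ : AddChar κ ℂ) (α ν : MulChar κ ℂ) : ℂ := gSo ψ (α * ν) / gSo ψ α

/-- The (binary) Jacobi sum `j(φ₁,φ₂) = -∑_{x₁+x₂=1} φ₁(x₁) φ₂(x₂)`. -/
def jac2 (φ₁ φ₂ : MulChar κ ℂ) : ℂ := -∑ t : κ, φ₁ t * φ₂ (1 - t)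

/-- The finite hypergeometric function for tuples `𝛂`, `𝛃` of multiplicative characters:
`F(𝛂,𝛃;λ) = (1/(1-q)) ∑_ν (∏ᵢ (αᵢ)_ν / ∏ⱼ (βⱼ)°_ν) ν(λ)`. -/
def FhT (ψ : AddChar κ ℂ) {m n : ℕ} (A : Fin m → MulChar κ ℂ) (B : Fin n → MulChar κ ℂ)
    (l : κ) : ℂ :=
  (1 - (Fintype.card κ : ℂ))⁻¹ *
    ∑ ν : MulChar κ ℂ, ((∏ i, poch ψ (A i) ν) / ∏ j, pocho ψ (B j) ν) * ν l

lemma gS_eq_neg_gaussSum (ψ : AddChar κ ℂ) (φ : MulChar κ ℂ) : gS ψ φ = -gaussSum φ ψ := by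
  simp only [gS, gaussSum, mul_comm]

lemma jac2_eq_neg_jacobiSum (φ₁ φ₂ : MulChar κ ℂ) : jac2 φ₁ φ₂ = -jacobiSum φ₁ φ₂ := rfl

lemma gS_one {ψ : AddChar κ ℂ} (hψ : ψ ≠ 1) : gS ψ (1 : MulChar κ ℂ) = 1 := by
  rw [gS_eq_neg_gaussSum, gaussSum_one_left hψ, neg_neg]

lemma gS_ne_zero {ψ : AddChar κ ℂ} (hψ : ψ ≠ 1) (φ : MulChar κ ℂ) : gS ψ φ ≠ 0 := by
  by_cases hφ : φ = 1
  · rw [hφ, gS_one hψ]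
    exact one_ne_zero
  · rw [gS_eq_neg_gaussSum, neg_ne_zero]
    exact gaussSum_ne_zero_of_nontrivial (Nat.cast_ne_zero.mpr Fintype.card_ne_zero) hφ
      (AddChar.IsPrimitive.of_ne_one hψ)

lemma gSo_ne_zero {ψ : AddChar κ ℂ} (hψ : ψ ≠ 1) (φ : MulChar κ ℂ) : gSo ψ φ ≠ 0 := by
  refine mul_ne_zero ?_ (gS_ne_zero hψ φ)
  split_ifs
  · exact Nat.cast_ne_zero.mpr Fintype.card_ne_zero
  · exact one_ne_zero

lemma jac2_mul_gSo {ψ : AddChar κ ℂ} (hψ : ψ ≠ 1) (φ : MulChar κ ℂ) {χ : MulChar κ ℂ}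
    (hχ : χ ≠ 1) : jac2 φ χ * gSo ψ (φ * χ) = gS ψ φ * gS ψ χ := by
  by_cases h : φ * χ = 1
  · obtain rfl : φ = χ⁻¹ := eq_inv_of_mul_eq_one_left h
    rw [gSo, if_pos h, h, gS_one hψ, jac2_eq_neg_jacobiSum, jacobiSum_comm,
      jacobiSum_nontrivial_inv hχ, gS_eq_neg_gaussSum, gS_eq_neg_gaussSum,
      ← gaussSum_mul_gaussSum_eq_card hχ (AddChar.IsPrimitive.of_ne_one hψ),
      ← mul_gaussSum_inv_eq_gaussSum χ⁻¹ ψ, MulChar.inv_apply', inv_neg_one]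
    ring
  · rw [gSo, if_neg h, gS_eq_neg_gaussSum, gS_eq_neg_gaussSum, gS_eq_neg_gaussSum,
      jac2_eq_neg_jacobiSum]
    linear_combination jacobiSum_mul_nontrivial h ψ

lemma jac2_mul_poch_div_pocho {ψ : AddChar κ ℂ} (hψ : ψ ≠ 1) {α β : MulChar κ ℂ} (hαβ : α ≠ β)
    (ν : MulChar κ ℂ) :
    jac2 α (α⁻¹ * β) * (poch ψ α ν / pocho ψ β ν) = jac2 (α * ν) (α⁻¹ * β) := by
  have hχ : α⁻¹ * β ≠ 1 := fun h => hαβ (inv_mul_eq_one.mp h)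
  have h₁ := jac2_mul_gSo hψ α hχ
  have h₂ := jac2_mul_gSo hψ (α * ν) hχ
  rw [mul_inv_cancel_left] at h₁
  rw [show α * ν * (α⁻¹ * β) = β * ν by
    rw [mul_comm α ν, mul_assoc, mul_inv_cancel_left, mul_comm]] at h₂
  have := gS_ne_zero hψ α
  have := gSo_ne_zero hψ β
  have := gSo_ne_zero hψ (β * ν)
  rw [poch, pocho]
  field_simp
  linear_combination gS ψ (α * ν) * h₁ - gS ψ α * h₂

/-- iteration formula: for `α ≠ β`,
`-j(α,ᾱβ) F(𝛂⌢(α),𝛃⌢(β);λ) = ∑_{t∈κ} F(𝛂,𝛃;λt) α(t) (ᾱβ)(1-t)`. -/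
theorem stmt_4 (ψ : AddChar κ ℂ) (hψ : ψ ≠ 1) {m n : ℕ}
    (A : Fin m → MulChar κ ℂ) (B : Fin n → MulChar κ ℂ)
    (α β : MulChar κ ℂ) (hαβ : α ≠ β) (l : κ) :
    -jac2 α (α⁻¹ * β) * FhT ψ (Fin.snoc A α) (Fin.snoc B β) l =
      ∑ t : κ, FhT ψ A B (l * t) * α t * (α⁻¹ * β) (1 - t) := by
  have hR (ν : MulChar κ ℂ) :
      ∑ t : κ, ν (l * t) * α t * (α⁻¹ * β) (1 - t) = -jac2 (α * ν) (α⁻¹ * β) * ν l := by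
    simp only [jac2, neg_neg, Finset.sum_mul]
    refine Finset.sum_congr rfl fun t _ => ?_
    rw [map_mul, MulChar.mul_apply α ν]
    ring
  simp only [FhT, Finset.mul_sum, Finset.sum_mul]
  rw [Finset.sum_comm]
  refine Finset.sum_congr rfl fun ν _ => ?_
  rw [Fin.prod_univ_castSucc, Fin.prod_univ_castSucc]
  simp only [Fin.snoc_castSucc, Fin.snoc_last]
  rw [mul_div_mul_comm]
  trans (1 - (Fintype.card κ : ℂ))⁻¹ * ((∏ i, poch ψ (A i) ν) / ∏ j, pocho ψ (B j) ν) *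
    ∑ t : κ, ν (l * t) * α t * (α⁻¹ * β) (1 - t)
  · rw [hR, ← jac2_mul_poch_div_pocho hψ hαβ ν]
    ring
  · rw [Finset.mul_sum]
    exact Finset.sum_congr rfl fun t _ => by ring

end
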